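/- arXiv:math/9807175 — 2 statements merged into one kernel-verified Lean document; each statement's English description precedes it below -/
import Mathlib

section
/- For every positive integer j, the poset P_j is polyunsaturated: for all distinct, nonconsecutive positive integers k, l < j+2 (i.e., k ≠ l and |k - l| ≥ 2, with k, l < h(P_j) = j+2), no chain partition of P_j is simultaneously k-saturated and l-saturated. -/
/-- The maximum cardinality of a union of `k` antichains (a `k`-family)
with respect to the relation `r`. -/
noncomputable def dFam {α : Type*} (r : α → α → Prop) (k : ℕ) : ℕ :=
  sSup {n | ∃ A : Fin k → Set α, (∀ i, IsAntichain r (A i)) ∧ (⋃ i, A i).ncard = n}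

/-- The height of a poset: the maximum cardinality of a chain. -/
noncomputable def heightPO {α : Type*} (r : α → α → Prop) : ℕ :=
  sSup {n | ∃ s : Set α, IsChain r s ∧ s.ncard = n}

/-- The width of a poset: the maximum cardinality of an antichain. -/
noncomputable def widthPO {α : Type*} (r : α → α → Prop) : ℕ :=
  sSup {n | ∃ s : Set α, IsAntichain r s ∧ s.ncard = n}

/-- `f` encodes a partition of `α` into chains: its (nonempty) fibers are the chains. -/
def IsChainPartition {α : Type*} (r : α → α → Prop) (f : α → α) : Prop :=
  ∀ i : α, IsChain r (f ⁻¹' {i})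

/-- The `k`-norm of the partition encoded by `f`: `Σ_C min (k, |C|)`. -/
noncomputable def knorm {α : Type*} [Fintype α] (f : α → α) (k : ℕ) : ℕ :=
  ∑ i : α, min k (f ⁻¹' {i}).ncard

/-- A poset is polyunsaturated if no chain partition is simultaneously `k`- and
`l`-saturated for distinct nonconsecutive positive `k, l` below the height. -/
def PolyunsatPO {α : Type*} [Fintype α] (r : α → α → Prop) : Prop :=
  ∀ k l : ℕ, 0 < k → 0 < l → k < heightPO r → l < heightPO r →
    (k + 2 ≤ l ∨ l + 2 ≤ k) →
    ¬ ∃ f : α → α, IsChainPartition r f ∧ knorm f k = dFam r k ∧ knorm f l = dFam r l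

/-- A poset has order dimension at most 2: two linear extensions whose
intersection is the order. -/
def DimLE2 {α : Type*} (r : α → α → Prop) : Prop :=
  ∃ L₁ L₂ : α → α → Prop, IsLinearOrder α L₁ ∧ IsLinearOrder α L₂ ∧
    (∀ x y, r x y → L₁ x y) ∧ (∀ x y, r x y → L₂ x y) ∧
    (∀ x y, r x y ↔ L₁ x y ∧ L₂ x y)


/-- Size of the chain `Q i` in the construction of the poset `P j`. -/
def qsize (i : ℕ) : ℕ := if i = 1 then 3 else i + 1

/-- Position (from the bottom) of the element `s i` within the chain `Q i`. -/
def sposn (i : ℕ) : ℕ := qsize i - 2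

/-- The underlying set of the poset `P j`: pairs `(i, m)` where `1 ≤ i ≤ j` indexes
the chain `Q i` and `m < qsize i` is the position within that chain. -/
def PJ (j : ℕ) : Type :=
  {p : Fin (j + 1) × Fin (j + 2) // 1 ≤ p.1.val ∧ p.1.val ≤ j ∧ p.2.val < qsize p.1.val}

instance (j : ℕ) : Fintype (PJ j) := by unfold PJ; infer_instance

instance (j : ℕ) : DecidableEq (PJ j) := by unfold PJ; infer_instance

/-- The order relation of `P j`. -/
def ple {j : ℕ} (x y : PJ j) : Prop :=
  (x.val.1.val = y.val.1.val ∧ x.val.2.val ≤ y.val.2.val) ∨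
  (x.val.1.val < y.val.1.val ∧ x.val.2.val ≤ sposn x.val.1.val ∧
    sposn y.val.1.val ≤ y.val.2.val)

instance (j : ℕ) : PartialOrder (PJ j) where
  le := ple
  le_refl x := Or.inl ⟨rfl, le_rfl⟩
  le_trans x y z hxy hyz := by
    simp only [ple] at hxy hyz ⊢
    rcases hxy with ⟨h1, h2⟩ | ⟨h1, h2, h3⟩ <;> rcases hyz with ⟨g1, g2⟩ | ⟨g1, g2, g3⟩
    · exact Or.inl ⟨h1.trans g1, h2.trans g2⟩
    · refine Or.inr ⟨by omega, ?_, g3⟩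
      rw [h1]; omega
    · refine Or.inr ⟨by omega, h2, ?_⟩
      rw [← g1]; omega
    · exact Or.inr ⟨by omega, h2, g3⟩
  le_antisymm x y hxy hyx := by
    simp only [ple] at hxy hyx
    rcases hxy with ⟨h1, h2⟩ | ⟨h1, h2, h3⟩ <;> rcases hyx with ⟨g1, g2⟩ | ⟨g1, g2, g3⟩
    · exact Subtype.ext (Prod.ext (Fin.ext h1) (Fin.ext (le_antisymm h2 g2)))
    all_goals (exfalso; omega)

/-- The order of `P j`, as an explicit relation. -/
def pjle (j : ℕ) : PJ j → PJ j → Prop := (· ≤ ·)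

/-- The element `u` of `P j`. -/
def uElt (j : ℕ) (hj : 1 ≤ j) : PJ j :=
  ⟨(⟨1, by omega⟩, ⟨0, by omega⟩), le_refl 1, hj, by show 0 < qsize 1; decide⟩

/-- The element `s i` of `P j`. -/
def sElt (j i : ℕ) (h1 : 1 ≤ i) (h2 : i ≤ j) : PJ j :=
  ⟨(⟨i, by omega⟩, ⟨sposn i, by simp only [sposn, qsize]; split <;> omega⟩),
    h1, h2, by show sposn i < qsize i; simp only [sposn, qsize]; split <;> omega⟩

/-- The element `r i` of `P j`. -/
def rElt (j i : ℕ) (h1 : 1 ≤ i) (h2 : i ≤ j) : PJ j :=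
  ⟨(⟨i, by omega⟩, ⟨qsize i - 1, by simp only [qsize]; split <;> omega⟩),
    h1, h2, by show qsize i - 1 < qsize i; simp only [qsize]; split <;> omega⟩


section Levels

variable {α : Type*} {r : α → α → Prop}

/-- A chain covered by `k` antichains has at most `k` elements. -/
lemma card_le_of_isChain_of_antichain_cover {k : ℕ} {A : Fin k → Set α}
    (hA : ∀ i, IsAntichain r (A i)) {C : Finset α} (hC : IsChain r (C : Set α))
    (hCA : ∀ x ∈ C, ∃ i, x ∈ A i) : C.card ≤ k := by
  classical
  rcases C.eq_empty_or_nonempty with rfl | ⟨x₀, hx₀⟩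
  · simp
  have : Nonempty (Fin k) := ⟨(hCA x₀ hx₀).choose⟩
  choose! idx hidx using hCA
  have h : C.card ≤ (Finset.univ : Finset (Fin k)).card := by
    refine Finset.card_le_card_of_injOn idx (fun _ _ => Finset.mem_coe.2 (Finset.mem_univ _)) ?_
    intro x hx y hy hxy
    by_contra hne
    have hxA := hidx x hx
    have hyA := hidx y hy
    rw [← hxy] at hyA
    rcases hC hx hy hne with h | h
    · exact hA _ hxA hyA hne h
    · exact hA _ hyA hxA (Ne.symm hne) h
  simpa using h

variable [Fintype α]

/-- If `lev` separates comparable elements of level below `k` and some chain partition `g` has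
every block either inside `{lev < k}` or meeting all levels below `k`, then `{lev < k}` is a
maximum `k`-family. -/
lemma dFam_eq_card_levels {β : Type*} {k : ℕ} (lev : α → ℕ)
    (hlev : ∀ x y, x ≠ y → r x y → lev x < k → lev y < k → lev x ≠ lev y)
    (g : α → β) (hg : ∀ x y, g x = g y → x ≠ y → r x y ∨ r y x)
    (hit : ∀ x, k ≤ lev x → ∀ t < k, ∃ y, g y = g x ∧ lev y = t) :
    dFam r k = (Finset.univ.filter fun x => lev x < k).card := by
  classical
  apply le_antisymm
  · refine csSup_le ⟨0, fun _ => ∅, by simp, by simp⟩ ?_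
    rintro n ⟨A, hA, rfl⟩
    rw [Set.ncard_eq_toFinset_card']
    rw [Finset.card_eq_sum_card_fiberwise (f := g) (t := Finset.univ.image g)
        (by intro x _; simp),
      Finset.card_eq_sum_card_fiberwise (f := g) (t := Finset.univ.image g)
        (s := Finset.univ.filter fun x => lev x < k) (by intro x _; simp)]
    refine Finset.sum_le_sum fun b _ => ?_
    by_cases hb : ∃ x, g x = b ∧ k ≤ lev x
    · obtain ⟨x, rfl, hx⟩ := hb
      calc _ ≤ k := by
            refine card_le_of_isChain_of_antichain_cover hA ?_ ?_
            · intro y hy z hz hne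
              simp only [Finset.coe_filter, Set.mem_ofPred_eq] at hy hz
              exact hg y z (hy.2.trans hz.2.symm) hne
            · intro y hy
              simpa using (Finset.mem_filter.1 hy).1
        _ = (Finset.range k).card := (Finset.card_range k).symm
        _ ≤ _ := by
            refine (Finset.card_le_card ?_).trans (Finset.card_image_le (f := lev))
            intro t ht
            obtain ⟨y, hy, rfl⟩ := hit x hx t (Finset.mem_range.1 ht)
            exact Finset.mem_image.2 ⟨y, by simpa [hy] using ht, rfl⟩
    · push Not at hb
      refine Finset.card_le_card fun x hx => ?_
      have hxb := (Finset.mem_filter.1 hx).2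
      simp [hxb, hb x hxb]
  · refine le_csSup ⟨Fintype.card α, ?_⟩ ⟨fun t => {x | lev x = t}, ?_, ?_⟩
    · rintro n ⟨A, -, rfl⟩
      rw [← Nat.card_eq_fintype_card]
      exact Set.ncard_le_card _
    · intro t x hx y hy hne h
      have hx' : lev x = t := hx
      have hy' : lev y = t := hy
      exact hlev x y hne h (hx' ▸ t.2) (hy' ▸ t.2) (hx'.trans hy'.symm)
    · rw [← Set.ncard_coe_finset]
      congr 1
      ext x
      simp only [Set.mem_iUnion, Set.mem_ofPred_eq, Finset.coe_filter, Finset.mem_univ, true_and]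
      exact ⟨fun ⟨i, hi⟩ => hi ▸ i.2, fun h => ⟨⟨lev x, h⟩, rfl⟩⟩

/-- If the `k`-norm of a chain partition equals the size of the `k`-family `{lev < k}`, then every
block not inside the family meets each of its levels. -/
lemma exists_level_of_knorm_eq {k : ℕ} (lev : α → ℕ)
    (hlev : ∀ x y, x ≠ y → r x y → lev x < k → lev y < k → lev x ≠ lev y)
    {f : α → α} (hf : IsChainPartition r f)
    (hk : knorm f k = (Finset.univ.filter fun x => lev x < k).card)
    {x : α} (hx : k ≤ lev x) {t : ℕ} (ht : t < k) : ∃ y, f y = f x ∧ lev y = t := by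
  classical
  set F := Finset.univ.filter fun x => lev x < k with hF
  have hinj : ∀ b, Set.InjOn lev ((F.filter fun y => f y = b : Finset α) : Set α) := by
    intro b y hy z hz hyz
    by_contra hne
    simp only [hF, Finset.coe_filter, Finset.mem_filter, Finset.mem_univ, true_and,
      Set.mem_ofPred_eq] at hy hz
    rcases hf b hy.2 hz.2 hne with h | h
    · exact hlev y z hne h hy.1 hz.1 hyz
    · exact hlev z y (Ne.symm hne) h hz.1 hy.1 hyz.symm
  have hsub : ∀ b, (F.filter fun y => f y = b).image lev ⊆ Finset.range k := by
    intro b s hs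
    obtain ⟨y, hy, rfl⟩ := Finset.mem_image.1 hs
    simpa [hF] using (Finset.mem_filter.1 (Finset.mem_filter.1 hy).1).2
  have hle : ∀ b ∈ (Finset.univ : Finset α),
      (F.filter fun y => f y = b).card ≤ min k (f ⁻¹' {b}).ncard := by
    intro b _
    refine le_min ?_ ?_
    · rw [← Finset.card_image_of_injOn (hinj b)]
      simpa using Finset.card_le_card (hsub b)
    · rw [← Set.ncard_coe_finset]
      refine Set.ncard_le_ncard ?_ (Set.toFinite _)
      intro y hy
      simpa using (Finset.mem_filter.1 hy).2
  have hsum : ∑ b, (F.filter fun y => f y = b).card = ∑ b, min k (f ⁻¹' {b}).ncard := by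
    rw [← Finset.card_eq_sum_card_fiberwise (f := f) (s := F) (t := Finset.univ)
      (fun _ _ => Finset.mem_coe.2 (Finset.mem_univ _))]
    exact hk.symm
  have heq := (Finset.sum_eq_sum_iff_of_le hle).1 hsum (f x) (Finset.mem_univ _)
  have hlt : (F.filter fun y => f y = f x).card < (f ⁻¹' {f x}).ncard := by
    rw [← Set.ncard_coe_finset]
    refine Set.ncard_lt_ncard ⟨?_, fun h => ?_⟩ (Set.toFinite _)
    · intro y hy
      simpa using (Finset.mem_filter.1 hy).2
    · have hxF : x ∈ F.filter fun y => f y = f x := h rfl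
      have := (Finset.mem_filter.1 (Finset.mem_filter.1 hxF).1).2
      omega
  have hcard : (F.filter fun y => f y = f x).card = k := by omega
  have himg : (F.filter fun y => f y = f x).image lev = Finset.range k := by
    refine Finset.eq_of_subset_of_card_le (hsub _) ?_
    rw [Finset.card_image_of_injOn (hinj _), hcard, Finset.card_range]
  obtain ⟨y, hy, hyt⟩ := Finset.mem_image.1 (himg ▸ Finset.mem_range.2 ht)
  exact ⟨y, (Finset.mem_filter.1 hy).2, hyt⟩

end Levels

lemma sposn_eq (i : ℕ) : sposn i = if i = 1 then 1 else i - 1 := by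
  unfold sposn qsize; split <;> omega

lemma qsize_eq {i : ℕ} (hi : 1 ≤ i) : qsize i = sposn i + 2 := by
  unfold sposn qsize; split <;> omega

/-- The level of position `m` of `Q i` in a maximum `k`-family of `P j`; elements outside the
family get level at least `k`. -/
def pjLevel (k i m : ℕ) : ℕ :=
  if m = sposn i + 1 then 0
  else if i + 2 ≤ k then
    if m = sposn i then k - 1 - i else if i = 1 then k - 1 else k - 2 - m
  else if m = sposn i then k else sposn i - m

/-- The block of position `m` of `Q i` in a `k`-saturated chain partition of `P j`: the chain
`u < s 1 < ⋯ < s (k - 1) < r (k - 1)`, the chains `T i` and singletons `r i` left over from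
`Q 1, …, Q (k - 1)`, and the chains `Q i` with `k ≤ i`. -/
def pjBlock (k i m : ℕ) : ℕ × ℕ :=
  if k ≤ i then (i, 0)
  else if m = sposn i + 1 ∧ i + 1 < k then (i, 1)
  else if i = 1 ∨ sposn i ≤ m then (0, 0)
  else (i, 2)

namespace PJ

variable {j : ℕ}

/-- The index of the chain `Q i` containing an element. -/
def idx (x : PJ j) : ℕ := x.val.1.val

/-- The position of an element in its chain. -/
def pos (x : PJ j) : ℕ := x.val.2.val

lemma one_le_idx (x : PJ j) : 1 ≤ x.idx := x.2.1

lemma idx_le (x : PJ j) : x.idx ≤ j := x.2.2.1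

lemma pos_le (x : PJ j) : x.pos ≤ sposn x.idx + 1 := by
  have h : x.pos < qsize x.idx := x.2.2.2
  have := qsize_eq x.one_le_idx
  omega

lemma ext_idx_pos {x y : PJ j} (h₁ : x.idx = y.idx) (h₂ : x.pos = y.pos) : x = y :=
  Subtype.ext (Prod.ext (Fin.ext h₁) (Fin.ext h₂))

lemma exists_idx_pos {i m : ℕ} (h1 : 1 ≤ i) (h2 : i ≤ j) (hm : m ≤ sposn i + 1) :
    ∃ x : PJ j, x.idx = i ∧ x.pos = m := by
  have hq := qsize_eq h1
  have hs := sposn_eq i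
  have : m < j + 2 := by split at hs <;> omega
  exact ⟨⟨(⟨i, by omega⟩, ⟨m, this⟩), h1, h2, by show m < qsize i; omega⟩, rfl, rfl⟩

lemma pjle_iff {x y : PJ j} : pjle j x y ↔ (x.idx = y.idx ∧ x.pos ≤ y.pos) ∨
    (x.idx < y.idx ∧ x.pos ≤ sposn x.idx ∧ sposn y.idx ≤ y.pos) := Iff.rfl

/-- The level of an element of `P j` in a maximum `k`-family. -/
def level (k : ℕ) (x : PJ j) : ℕ := pjLevel k x.idx x.pos

lemma level_ne {k : ℕ} (x y : PJ j) (hne : x ≠ y) (h : pjle j x y)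
    (hx : x.level k < k) (_ : y.level k < k) : x.level k ≠ y.level k := by
  have h1 := x.one_le_idx
  have h2 := y.one_le_idx
  have h3 := x.pos_le
  have h4 := y.pos_le
  have h5 : ¬ (x.idx = y.idx ∧ x.pos = y.pos) := fun h => hne (ext_idx_pos h.1 h.2)
  rw [pjle_iff] at h
  unfold level pjLevel at *
  generalize x.idx = a at *
  generalize y.idx = b at *
  generalize x.pos = m at *
  generalize y.pos = n at *
  clear hne
  simp only [sposn_eq] at *
  grind

lemma comparable_of_pjBlock_eq {k : ℕ} (x y : PJ j)
    (h : pjBlock k x.idx x.pos = pjBlock k y.idx y.pos) (_ : x ≠ y) :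
    pjle j x y ∨ pjle j y x := by
  have h1 := x.one_le_idx
  have h2 := y.one_le_idx
  have h3 := x.pos_le
  have h4 := y.pos_le
  rw [pjle_iff, pjle_iff]
  unfold pjBlock at h
  generalize x.idx = a at *
  generalize y.idx = b at *
  generalize x.pos = m at *
  generalize y.pos = n at *
  have ha := sposn_eq a
  have hb := sposn_eq b
  generalize sposn a = c at *
  generalize sposn b = d at *
  split_ifs at h <;> simp only [Prod.mk.injEq] at h <;> grind

lemma exists_level_pjBlock {k : ℕ} (hk : 0 < k) (x : PJ j) (hx : k ≤ x.level k)
    (t : ℕ) (ht : t < k) :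
    ∃ y : PJ j, pjBlock k y.idx y.pos = pjBlock k x.idx x.pos ∧ y.level k = t := by
  suffices h : ∃ i m, 1 ≤ i ∧ i ≤ j ∧ m ≤ sposn i + 1 ∧
      pjBlock k i m = pjBlock k x.idx x.pos ∧ pjLevel k i m = t by
    obtain ⟨i, m, h1, h2, h3, h4, h5⟩ := h
    obtain ⟨y, rfl, rfl⟩ := exists_idx_pos h1 h2 h3
    exact ⟨y, h4, h5⟩
  have h1 := x.one_le_idx
  have h2 := x.idx_le
  have h3 := x.pos_le
  unfold level at hx
  generalize x.idx = a at *
  generalize x.pos = m at *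
  by_cases hka : k ≤ a
  · refine ⟨a, if t = 0 then sposn a + 1 else sposn a - t, h1, h2, ?_, ?_, ?_⟩
    · split <;> omega
    · simp [pjBlock, hka]
    · unfold pjLevel
      simp only [sposn_eq] at *
      grind
  · have hs : a = k - 1 ∧ m = sposn a := by
      unfold pjLevel at hx
      simp only [sposn_eq] at *
      grind
    obtain ⟨hak, rfl⟩ := hs
    have hblock : pjBlock k a (sposn a) = (0, 0) := by
      simp [pjBlock, hka]
    rw [hblock]
    rcases Nat.eq_zero_or_pos t with rfl | htpos
    · refine ⟨a, sposn a + 1, h1, h2, le_rfl, ?_, ?_⟩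
      · simp [pjBlock, hka]; omega
      · simp [pjLevel]
    · by_cases htk : t = k - 1
      · refine ⟨1, 0, le_rfl, by omega, by omega, ?_, ?_⟩ <;>
          simp only [pjBlock, pjLevel, sposn_eq] <;> grind
      · refine ⟨k - 1 - t, sposn (k - 1 - t), by omega, by omega, by omega, ?_, ?_⟩ <;>
          simp only [pjBlock, pjLevel, sposn_eq] <;> grind

lemma dFam_pjle {k : ℕ} (hk : 0 < k) :
    dFam (pjle j) k = (Finset.univ.filter fun x : PJ j => x.level k < k).card :=
  dFam_eq_card_levels (level k) level_ne (fun x => pjBlock k x.idx x.pos)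
    comparable_of_pjBlock_eq (exists_level_pjBlock hk)

lemma pos_eq_of_level_eq_zero {k : ℕ} (hk : 0 < k) {x : PJ j} (hx : x.level k = 0) :
    x.pos = sposn x.idx + 1 := by
  have h1 := x.one_le_idx
  have h3 := x.pos_le
  unfold level pjLevel at hx
  simp only [sposn_eq] at *
  grind

lemma comparable_of_eq {f : PJ j → PJ j} (hf : IsChainPartition (pjle j) f) {x y : PJ j}
    (h : f x = f y) : pjle j x y ∨ pjle j y x := by
  rcases eq_or_ne x y with rfl | hne
  · exact Or.inl (le_refl x)
  · exact hf (f y) h rfl hne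

/-- In a `k`-saturated chain partition, the least and greatest elements of `Q i` share a block
whenever `k < i`. -/
lemma bot_top_same_block {k : ℕ} (hk : 0 < k) {f : PJ j → PJ j}
    (hf : IsChainPartition (pjle j) f) (hfk : knorm f k = dFam (pjle j) k) (d : ℕ) :
    ∀ x y : PJ j, x.idx + d = j → k < x.idx → y.idx = x.idx → x.pos = 0 →
      y.pos = sposn y.idx + 1 → f y = f x := by
  induction d using Nat.strong_induction_on with
  | _ d ih =>
    intro x y hd hkx hyx hx0 hy
    have hlev : k ≤ x.level k := by
      have := x.one_le_idx
      simp only [level, pjLevel, sposn_eq, hx0]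
      grind
    obtain ⟨z, hz, hz0⟩ := exists_level_of_knorm_eq (level k) level_ne hf
      (hfk.trans (dFam_pjle hk)) hlev hk
    have hzp := pos_eq_of_level_eq_zero hk hz0
    have hzj := z.idx_le
    have hxz : x.idx ≤ z.idx := by
      rcases comparable_of_eq hf hz with h | h <;> rw [pjle_iff] at h <;> omega
    rcases hxz.eq_or_lt with h | h
    · rwa [ext_idx_pos (hyx.trans h) (by rw [hy, hzp, hyx, h])]
    · exfalso
      obtain ⟨w, hw, hw0⟩ := exists_idx_pos (j := j) (i := z.idx) (m := 0) (by omega) hzj (by omega)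
      have hzw := ih (j - w.idx) (by omega) w z (by omega) (by omega) hw.symm hw0 hzp
      have hsx := sposn_eq x.idx
      have hsw := sposn_eq w.idx
      rcases comparable_of_eq hf (hzw.symm.trans hz) with h | h <;> rw [pjle_iff] at h <;>
        split_ifs at hsx hsw <;> omega

/-- No chain partition of `P j` is both `k`- and `l`-saturated when `k + 2 ≤ l < j + 2`. -/
lemma not_saturated_of_add_two_le {k l : ℕ} (hk : 0 < k) (hkl : k + 2 ≤ l) (hl : l < j + 2)
    {f : PJ j → PJ j} (hf : IsChainPartition (pjle j) f)
    (hfk : knorm f k = dFam (pjle j) k) (hfl : knorm f l = dFam (pjle j) l) : False := by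
  have hl0 : 0 < l := by omega
  obtain ⟨s, hs, hsp⟩ := exists_idx_pos (j := j) (i := l - 1) (m := sposn (l - 1))
    (by omega) (by omega) (by omega)
  have hlev : l ≤ s.level l := by
    simp only [level, pjLevel, hs, hsp]
    grind
  have hlevels := fun t (ht : t < l) => exists_level_of_knorm_eq (level l) level_ne hf
    (hfl.trans (dFam_pjle hl0)) hlev ht
  obtain ⟨z, hz, hz0⟩ := hlevels 0 hl0
  obtain ⟨u, hu, hul⟩ := hlevels (l - 1) (by omega)
  have hzp := pos_eq_of_level_eq_zero hl0 hz0
  have hsz : l - 1 ≤ z.idx := by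
    rcases comparable_of_eq hf hz with h | h <;> rw [pjle_iff] at h <;> omega
  have hu1 : u.idx = 1 ∧ u.pos = 0 := by
    have h1 := u.one_le_idx
    have h3 := u.pos_le
    have hc := comparable_of_eq hf hu
    simp only [pjle_iff, hs, hsp] at hc
    unfold level pjLevel at hul
    generalize u.idx = a at *
    generalize u.pos = m at *
    clear hlevels hlev
    simp only [sposn_eq] at *
    grind
  obtain ⟨w, hw, hw0⟩ := exists_idx_pos (j := j) (i := z.idx) (m := 0) z.one_le_idx z.idx_le
    (by omega)
  have hzw := bot_top_same_block hk hf hfk (j - w.idx) w z (by have := w.idx_le; omega)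
    (by omega) hw.symm hw0 hzp
  have hsw := sposn_eq w.idx
  rcases comparable_of_eq hf (hu.trans (hz.symm.trans hzw)) with h | h <;> rw [pjle_iff] at h <;>
    split_ifs at hsw <;> omega

end PJ

/-- For every positive integer `j`, the poset `P j` is polyunsaturated: for all distinct,
nonconsecutive positive integers `k, l < j + 2 = h(P j)`, no chain partition of `P j`
is simultaneously `k`-saturated and `l`-saturated. -/
theorem statement4 (j : ℕ) (hj : 1 ≤ j) :
    ∀ k l : ℕ, 0 < k → 0 < l → k < j + 2 → l < j + 2 → (k + 2 ≤ l ∨ l + 2 ≤ k) →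
      ¬ ∃ f : PJ j → PJ j, IsChainPartition (pjle j) f ∧
          knorm f k = dFam (pjle j) k ∧ knorm f l = dFam (pjle j) l := by
  rintro k l hk hl hkj hlj (hkl | hlk) ⟨f, hf, hfk, hfl⟩
  · exact PJ.not_saturated_of_add_two_le hk hkl hlj hf hfk hfl
  · exact PJ.not_saturated_of_add_two_le hl hlk hkj hf hfl hfk
end

section
/- Let c be a positive integer and let b_1 ≥ b_2 ≥ … ≥ b_c be a nonincreasing sequence of positive integers. There exists a polyunsaturated poset P with height c such that Δd_k(P) = b_k for k = 1, …, c if and only if b_2 > b_3 > … > b_{c-1}. Moreover, P may be required to have order dimension at most 2. -/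
section Families

variable {α : Type*} [Fintype α] {r : α → α → Prop} {k : ℕ}

theorem ncard_iUnion_le_dFam {A : Fin k → Set α} (hA : ∀ i, IsAntichain r (A i)) :
    (⋃ i, A i).ncard ≤ dFam r k := by
  refine le_csSup ⟨Fintype.card α, ?_⟩ ⟨A, hA, rfl⟩
  rintro n ⟨B, -, rfl⟩
  rw [← Nat.card_eq_fintype_card, ← Set.ncard_univ]
  exact Set.ncard_le_ncard (Set.subset_univ _)

theorem exists_ncard_eq_dFam (r : α → α → Prop) (k : ℕ) :
    ∃ A : Fin k → Set α, (∀ i, IsAntichain r (A i)) ∧ (⋃ i, A i).ncard = dFam r k := by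
  have h : dFam r k ∈ {n | ∃ A : Fin k → Set α, (∀ i, IsAntichain r (A i)) ∧
      (⋃ i, A i).ncard = n} := by
    refine Nat.sSup_mem ⟨_, fun _ => ∅, by simp, rfl⟩ ⟨Fintype.card α, ?_⟩
    rintro n ⟨B, -, rfl⟩
    rw [← Nat.card_eq_fintype_card, ← Set.ncard_univ]
    exact Set.ncard_le_ncard (Set.subset_univ _)
  exact h

/-- `lev` splits `S` into antichains indexed by `K`. -/
def IsLeveled (r : α → α → Prop) (S : Finset α) (lev : α → ℕ) (K : Finset ℕ) : Prop :=
  (∀ u ∈ S, lev u ∈ K) ∧ ∀ u ∈ S, ∀ v ∈ S, r u v → u ≠ v → lev u ≠ lev v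

theorem IsLeveled.card_le_dFam {S : Finset α} {lev : α → ℕ} {K : Finset ℕ}
    (h : IsLeveled r S lev K) (hK : K.card = k) : S.card ≤ dFam r k := by
  let e : K ≃ Fin k := K.equivFinOfCardEq hK
  let A : Fin k → Set α := fun i => {u | u ∈ S ∧ lev u = (e.symm i : ℕ)}
  have hA : ∀ i, IsAntichain r (A i) := by
    rintro i u ⟨hu, hu'⟩ v ⟨hv, hv'⟩ huv hr
    exact h.2 u hu v hv hr huv (hu'.trans hv'.symm)
  refine le_trans (le_of_eq ?_) (ncard_iUnion_le_dFam hA)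
  rw [← Set.ncard_coe_finset]
  congr 1
  ext u
  simp only [Set.mem_iUnion, A, Finset.mem_coe, Set.mem_ofPred_eq]
  refine ⟨fun hu => ⟨e ⟨lev u, h.1 u hu⟩, hu, by simp⟩, fun ⟨_, hu, _⟩ => hu⟩

open Classical in
/-- A maximum `k`-family as a finset; it meets every chain at most `k` times. -/
theorem exists_kFamily (r : α → α → Prop) (k : ℕ) :
    ∃ T : Finset α, T.card = dFam r k ∧
      ∀ C : Finset α, IsChain r (C : Set α) → (C ∩ T).card ≤ k := by
  obtain ⟨A, hA, hcard⟩ := exists_ncard_eq_dFam r k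
  refine ⟨(⋃ i, A i).toFinset, by rw [← hcard, Set.ncard_eq_toFinset_card'], fun C hC => ?_⟩
  have hex : ∀ u : α, ∃ i : Option (Fin k), u ∈ C ∩ (⋃ i, A i).toFinset →
      ∃ j, i = some j ∧ u ∈ A j := by
    intro u
    by_cases hu : u ∈ C ∩ (⋃ i, A i).toFinset
    · have := (Finset.mem_inter.1 hu).2
      rw [Set.mem_toFinset, Set.mem_iUnion] at this
      obtain ⟨j, hj⟩ := this
      exact ⟨some j, fun _ => ⟨j, rfl, hj⟩⟩
    · exact ⟨none, fun h => (hu h).elim⟩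
  choose g hg using hex
  have hmaps : ∀ u ∈ C ∩ (⋃ i, A i).toFinset,
      g u ∈ (Finset.univ : Finset (Fin k)).map Function.Embedding.some := by
    intro u hu
    obtain ⟨j, hj, -⟩ := hg u hu
    simp [hj]
  have hinj : Set.InjOn g (C ∩ (⋃ i, A i).toFinset : Finset α) := by
    intro u hu v hv huv
    by_contra hne
    obtain ⟨j, hj, huj⟩ := hg u hu
    obtain ⟨j', hj', hvj⟩ := hg v hv
    have hjj : j = j' := Option.some.inj (hj.symm.trans (huv.trans hj'))
    subst hjj
    rcases hC (Finset.mem_inter.1 hu).1 (Finset.mem_inter.1 hv).1 hne with h | h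
    · exact hA j huj hvj hne h
    · exact hA j hvj huj (Ne.symm hne) h
  simpa using Finset.card_le_card_of_injOn g hmaps hinj

open Classical in
theorem dFam_le_of_slack {ι : Type*} (g : α → ι)
    (hg : ∀ u v, g u = g v → r u v ∨ r v u) (S : Finset α) (lev : α → ℕ) (K : Finset ℕ)
    (hK : K.card = k)
    (hS : ∀ u, u ∉ S → ∀ l ∈ K, ∃ v ∈ S, g v = g u ∧ lev v = l) :
    dFam r k ≤ S.card := by
  obtain ⟨T, hT, hTC⟩ := exists_kFamily r k
  rw [← hT, Finset.card_eq_sum_card_image g T,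
    Finset.card_eq_sum_card_fiberwise (f := g) (t := Finset.univ.image g) (s := S)
      (fun u _ => by simp)]
  refine le_trans (Finset.sum_le_sum_of_subset (Finset.image_subset_image (Finset.subset_univ T)))
    (Finset.sum_le_sum fun i _ => ?_)
  by_cases h : ∃ u, g u = i ∧ u ∉ S
  · obtain ⟨u, rfl, hu⟩ := h
    have h1 : (T.filter (fun v => g v = g u)).card ≤ k := by
      refine le_trans (Finset.card_le_card ?_)
        (hTC (Finset.univ.filter (fun v => g v = g u)) ?_)
      · intro v; simp +contextual
      · intro v hv w hw _
        simp only [Finset.coe_filter, Finset.mem_univ, true_and, Set.mem_ofPred_eq] at hv hw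
        exact hg v w (hv.trans hw.symm)
    refine h1.trans ?_
    rw [← hK]
    refine le_trans (Finset.card_le_card (t := (S.filter (fun v => g v = g u)).image lev) ?_)
      Finset.card_image_le
    intro l hl
    obtain ⟨v, hv, hgv, hlv⟩ := hS u hu l hl
    exact Finset.mem_image.2 ⟨v, by simp [hv, hgv], hlv⟩
  · push Not at h
    refine Finset.card_le_card fun v hv => ?_
    simp only [Finset.mem_filter] at hv ⊢
    exact ⟨h v hv.2, hv.2⟩

open Classical in
theorem knorm_eq_sum (f : α → α) (k : ℕ) :
    knorm f k = ∑ i, min k (Finset.univ.filter (fun v => f v = i)).card := by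
  unfold knorm
  refine Finset.sum_congr rfl fun i _ => ?_
  rw [← Set.ncard_coe_finset]
  congr 2
  ext; simp

omit [Fintype α] in
theorem IsChainPartition.comparable {f : α → α} (hf : IsChainPartition r f) {u v : α}
    (h : f u = f v) (hne : u ≠ v) : r u v ∨ r v u :=
  hf (f v) (by simpa using h) (by simp) hne

open Classical in
theorem dFam_le_knorm {f : α → α} (hf : IsChainPartition r f) (k : ℕ) :
    dFam r k ≤ knorm f k := by
  obtain ⟨T, hT, hTC⟩ := exists_kFamily r k
  rw [← hT, knorm_eq_sum,
    Finset.card_eq_sum_card_fiberwise (f := f) (t := Finset.univ) (s := T) (fun u _ => by simp)]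
  refine Finset.sum_le_sum fun i _ => le_min ?_ ?_
  · refine le_trans (Finset.card_le_card ?_)
      (hTC (Finset.univ.filter (fun v => f v = i)) ?_)
    · intro v; simp +contextual
    · intro v hv w hw hne
      simp only [Finset.coe_filter, Finset.mem_univ, true_and, Set.mem_ofPred_eq] at hv hw
      exact hf.comparable (hv.trans hw.symm) hne
  · exact Finset.card_le_card (Finset.filter_subset_filter _ (Finset.subset_univ T))

open Classical in
/-- In a `k`-saturated partition, a chain not contained in a maximum `k`-family meets each of
its antichains. -/
theorem slack_of_saturated {f : α → α} (hf : IsChainPartition r f) {S : Finset α} {lev : α → ℕ}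
    {K : Finset ℕ} (hS : IsLeveled r S lev K) (hK : K.card = k) (hsat : knorm f k ≤ S.card)
    {u : α} (hu : u ∉ S) {l : ℕ} (hl : l ∈ K) : ∃ v ∈ S, f v = f u ∧ lev v = l := by
  have hmaps : ∀ i, Set.MapsTo lev (S.filter (fun v => f v = i)) K := by
    intro i v hv
    exact hS.1 v (Finset.mem_filter.1 hv).1
  have hinj : ∀ i, Set.InjOn lev (S.filter (fun v => f v = i) : Finset α) := by
    intro i v hv w hw hvw
    simp only [Finset.coe_filter, Set.mem_ofPred_eq] at hv hw
    by_contra hne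
    rcases hf.comparable (hv.2.trans hw.2.symm) hne with h | h
    · exact hS.2 v hv.1 w hw.1 h hne hvw
    · exact hS.2 w hw.1 v hv.1 h (Ne.symm hne) hvw.symm
  have hle : ∀ i ∈ Finset.univ, (S.filter (fun v => f v = i)).card ≤
      min k (Finset.univ.filter (fun v => f v = i)).card := fun i _ => le_min
    (hK ▸ Finset.card_le_card_of_injOn lev (hmaps i) (hinj i))
    (Finset.card_le_card (Finset.filter_subset_filter _ (Finset.subset_univ S)))
  rw [knorm_eq_sum, Finset.card_eq_sum_card_fiberwise (f := f) (t := Finset.univ) (s := S)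
    (fun u _ => by simp)] at hsat
  have heq := (Finset.sum_eq_sum_iff_of_le hle).1 (le_antisymm (Finset.sum_le_sum hle) hsat)
    (f u) (Finset.mem_univ _)
  have hlt : (S.filter (fun v => f v = f u)).card <
      (Finset.univ.filter (fun v => f v = f u)).card := by
    refine Finset.card_lt_card (Finset.ssubset_iff_subset_ne.2
      ⟨Finset.filter_subset_filter _ (Finset.subset_univ S), fun h => hu ?_⟩)
    have : u ∈ S.filter (fun v => f v = f u) := by rw [h]; simp
    exact (Finset.mem_filter.1 this).1
  have hcard : K.card ≤ (S.filter (fun v => f v = f u)).card := by omega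
  obtain ⟨v, hv, hvl⟩ := Finset.surjOn_of_injOn_of_card_le lev (hmaps _) (hinj _) hcard hl
  rw [Finset.mem_coe, Finset.mem_filter] at hv
  exact ⟨v, hv.1, hv.2, hvl⟩

theorem heightPO_eq {c : ℕ} {lev : α → ℕ} (h : IsLeveled r Finset.univ lev (Finset.range c))
    {C : Finset α} (hC : IsChain r (C : Set α)) (hcard : C.card = c) : heightPO r = c := by
  have hbound : ∀ n ∈ {n | ∃ s : Set α, IsChain r s ∧ s.ncard = n}, n ≤ c := by
    classical
    rintro n ⟨s, hs, rfl⟩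
    rw [Set.ncard_eq_toFinset_card', ← Finset.card_range c]
    refine Finset.card_le_card_of_injOn lev (fun u _ => h.1 u (Finset.mem_univ u)) ?_
    intro u hu v hv huv
    by_contra hne
    simp only [Set.coe_toFinset] at hu hv
    rcases hs hu hv hne with h' | h'
    · exact h.2 u (Finset.mem_univ u) v (Finset.mem_univ v) h' hne huv
    · exact h.2 v (Finset.mem_univ v) u (Finset.mem_univ u) h' (Ne.symm hne) huv.symm
  have hmem : c ∈ {n | ∃ s : Set α, IsChain r s ∧ s.ncard = n} :=
    ⟨C, hC, by rw [Set.ncard_coe_finset, hcard]⟩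
  exact le_antisymm (csSup_le ⟨c, hmem⟩ hbound) (le_csSup ⟨c, hbound⟩ hmem)

end Families

section Assignment

variable {V : Type*}

/-- The cost of the path which traverses the list from its end to its head. -/
def pathCost (a : V → V → ℤ) : List V → ℤ
  | [] => 0
  | [_] => 0
  | w :: v :: l => a v w + pathCost a (v :: l)

theorem pathCost_append (a : V → V → ℤ) (w : V) (l₂ : List V) (l₁ : List V) :
    pathCost a (l₁ ++ w :: l₂) = pathCost a (l₁ ++ [w]) + pathCost a (w :: l₂) := by
  induction l₁ with
  | nil => simp [pathCost]
  | cons x l ih =>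
    cases l with
    | nil => simp [pathCost]
    | cons y l =>
      simp only [List.cons_append, pathCost] at ih ⊢
      rw [ih]; ring

variable [Fintype V] [DecidableEq V]

theorem exists_perm_of_nodup {a : V → V → ℤ} (h0 : ∀ v, a v v = 0) (w : V) (l : List V) :
    ∀ v, (v :: l).Nodup → (v :: l).getLast (by simp) = w →
      ∃ τ : Equiv.Perm V, τ v = w ∧ (∀ x, x ∉ v :: l → τ x = x) ∧
        ∑ x, a x (τ x) = pathCost a (v :: l) + a v w := by
  induction l with
  | nil =>
    intro v _ hv
    simp only [List.getLast_singleton] at hv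
    subst hv
    exact ⟨1, by simp, by simp, by simp [pathCost, h0]⟩
  | cons v l ih =>
    intro u hnd hlast
    have huv := (List.nodup_cons.1 hnd).1
    obtain ⟨τ, hτv, hτ, hsum⟩ := ih v (List.nodup_cons.1 hnd).2
      (by rw [List.getLast_cons (by simp)] at hlast; exact hlast)
    have hne : u ≠ v := fun h => huv (by simp [h])
    refine ⟨τ * Equiv.swap u v, by simp [hτv], ?_, ?_⟩
    · intro x hx
      simp only [List.mem_cons, not_or] at hx
      rw [Equiv.Perm.mul_apply, Equiv.swap_apply_of_ne_of_ne hx.1 hx.2.1]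
      exact hτ x (by simp [hx.2])
    · have hsub : ∑ x, (a x ((τ * Equiv.swap u v) x) - a x (τ x)) =
          ∑ x ∈ {u, v}, (a x ((τ * Equiv.swap u v) x) - a x (τ x)) := by
        symm
        refine Finset.sum_subset (Finset.subset_univ _) fun x _ hx => ?_
        simp only [Finset.mem_insert, Finset.mem_singleton, not_or] at hx
        rw [Equiv.Perm.mul_apply, Equiv.swap_apply_of_ne_of_ne hx.1 hx.2, sub_self]
      rw [Finset.sum_sub_distrib, Finset.sum_pair hne, hsum] at hsub
      simp only [Equiv.Perm.mul_apply, Equiv.swap_apply_left, Equiv.swap_apply_right, hτv,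
        hτ u huv, h0] at hsub
      simp only [pathCost, Equiv.Perm.mul_apply]
      linarith

/-- If the identity is a cheapest permutation, there is a feasible potential. -/
theorem exists_potential {a : V → V → ℤ} (h0 : ∀ v, a v v = 0)
    (hp : ∀ τ : Equiv.Perm V, 0 ≤ ∑ x, a x (τ x)) :
    ∃ p : V → ℤ, ∀ v w, p w ≤ p v + a v w := by
  have hmin : ∀ v, ∃ l : List V, (v :: l).Nodup ∧
      ∀ l' : List V, (v :: l').Nodup → pathCost a (v :: l) ≤ pathCost a (v :: l') := by
    intro v
    have : Nonempty {m : {l : List V // l.Nodup} // ∃ l, m.1 = v :: l} :=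
      ⟨⟨⟨[v], by simp⟩, [], rfl⟩⟩
    obtain ⟨⟨m, l, hl⟩, h⟩ := Finite.exists_min
      (fun m : {m : {l : List V // l.Nodup} // ∃ l, m.1 = v :: l} => pathCost a m.1.1)
    exact ⟨l, hl ▸ m.2, fun l' hl' => hl ▸ h ⟨⟨v :: l', hl'⟩, l', rfl⟩⟩
  choose l hnd hl using hmin
  refine ⟨fun v => pathCost a (v :: l v), fun v w => ?_⟩
  by_cases hw : w ∈ v :: l v
  · obtain ⟨l₁, l₂, h⟩ := List.append_of_mem hw
    have hnd' := hnd v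
    rw [h] at hnd'
    have h2 : (w :: l₂).Nodup := hnd'.of_append_right
    have h3 : (l₁ ++ [w]).Nodup :=
      hnd'.sublist (List.Sublist.append_left (by simp) _)
    have h4 : ∃ l₃, l₁ ++ [w] = v :: l₃ := by
      cases l₁ with
      | nil => simp only [List.nil_append, List.cons.injEq] at h; exact ⟨[], by simp [h.1]⟩
      | cons x l₁ =>
        simp only [List.cons_append, List.cons.injEq] at h
        exact ⟨l₁ ++ [w], by simp [h.1]⟩
    obtain ⟨l₃, h4⟩ := h4
    have hlast : (v :: l₃).getLast (by simp) = w := by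
      simp only [← h4, List.getLast_append_singleton]
    obtain ⟨τ, -, -, hτ⟩ := exists_perm_of_nodup h0 w l₃ v (h4 ▸ h3) hlast
    have h5 := hp τ
    have h6 := hl w l₂ h2
    simp only
    rw [h, pathCost_append, h4]
    linarith
  · have := hl w (v :: l v) (List.nodup_cons.2 ⟨hw, hnd v⟩)
    simp only [pathCost] at this
    simp only
    linarith

/-- Egerváry's theorem: integral duality for the assignment problem. -/
theorem exists_assignment_dual (cost : V → V → ℤ) :
    ∃ (σ : Equiv.Perm V) (p q : V → ℤ),
      (∀ x y, p y + q x ≤ cost x y) ∧ ∀ x, p (σ x) + q x = cost x (σ x) := by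
  obtain ⟨σ, hσ⟩ := Finite.exists_min (fun σ : Equiv.Perm V => ∑ x, cost x (σ x))
  obtain ⟨p, hp⟩ := exists_potential (a := fun v w => cost v (σ w) - cost v (σ v))
    (fun v => sub_self _) (fun τ => by
      have := hσ (σ * τ)
      simp only [Equiv.Perm.mul_apply] at this
      rw [Finset.sum_sub_distrib]
      linarith)
  refine ⟨σ, fun y => p (σ.symm y), fun x => cost x (σ x) - p x, fun x y => ?_, fun x => ?_⟩
  · have := hp x (σ.symm y)
    simp only [Equiv.apply_symm_apply] at this
    linarith
  · simp

end Assignment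

section GreeneKleitman

open Classical in
/-- Following a permutation along its ascents splits a finite poset into chains; the chain of `x`
is labelled by its top element. -/
theorem exists_ascent_partition {α : Type*} [Finite α] [PartialOrder α] (σ : Equiv.Perm α) :
    ∃ f : α → α, (∀ x, ¬ f x < σ (f x)) ∧ (∀ x y, f x = f y → x ≤ y ∨ y ≤ x) ∧
      ∀ t, σ t = t → ∀ x, f x = t → x = t := by
  let step : α → α → Prop := fun u v => v = σ u ∧ u < v
  have hwf : WellFounded (fun x y : α => y < x) := (inferInstance : WellFoundedGT α).wf
  let f : α → α := hwf.fix fun x F => if h : x < σ x then F (σ x) h else x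
  have hf : ∀ x, f x = if x < σ x then f (σ x) else x := fun x => by
    have := hwf.fix_eq (fun x (F : ∀ y, x < y → α) => if h : x < σ x then F (σ x) h else x) x
    simpa using this
  have hle : ∀ x y, Relation.ReflTransGen step x y → x ≤ y := by
    intro x y h
    induction h with
    | refl => exact le_rfl
    | tail _ h ih => exact ih.trans h.2.le
  have hend : ∀ x, ¬ f x < σ (f x) := by
    intro x
    induction x using hwf.induction with
    | _ x ih =>
      rw [hf x]
      split_ifs with h
      · exact ih _ h
      · exact h
  have hreach : ∀ x, Relation.ReflTransGen step x (f x) := by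
    intro x
    induction x using hwf.induction with
    | _ x ih =>
      rw [hf x]
      split_ifs with h
      · exact (ih _ h).head ⟨rfl, h⟩
      · exact Relation.ReflTransGen.refl
  have hcomp : ∀ x y, f x = f y →
      Relation.ReflTransGen step x y ∨ Relation.ReflTransGen step y x := by
    intro x
    induction x using hwf.induction with
    | _ x ih =>
      intro y hxy
      rw [hf x] at hxy
      split_ifs at hxy with h
      · rcases ih _ h y hxy with h' | h'
        · exact Or.inl (h'.head ⟨rfl, h⟩)
        · rcases Relation.ReflTransGen.cases_tail h' with h'' | ⟨z, hyz, hz, -⟩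
          · exact Or.inl (Relation.ReflTransGen.single ⟨h''.symm ▸ rfl, h'' ▸ h⟩)
          · rw [σ.injective hz]
            exact Or.inr hyz
      · right
        have := hreach y
        rwa [← hxy] at this
  refine ⟨f, hend, fun x y h => (hcomp x y h).imp (hle x y) (hle y x), fun t ht x hx => ?_⟩
  have h := hreach x
  rw [hx] at h
  rcases Relation.ReflTransGen.cases_tail h with h' | ⟨z, -, hz, hlt⟩
  · exact h'.symm
  · rw [σ.injective (ht.trans hz)] at hlt
    exact (lt_irrefl _ hlt).elim

variable {α : Type*} [Fintype α] {r : α → α → Prop} {k : ℕ}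

/-- Dual potentials of the assignment problem give a `k`-family and a `(k + 1)`-family. -/
theorem sum_potential_le (p q : α → ℤ)
    (hlt : ∀ x y, r x y → x ≠ y → p y + q x ≤ 0) (hself : ∀ x, p x + q x ≤ 2)
    (hall : ∀ x y, p y + q x ≤ 2 * k + 1) :
    ∑ x, (p x + q x) ≤ dFam r k + dFam r (k + 1) := by
  classical
  cases isEmpty_or_nonempty α with
  | inl h => simp only [Finset.univ_eq_empty, Finset.sum_empty]; positivity
  | inr h =>
    obtain ⟨z, hz⟩ := Finite.exists_min (fun x => - q x)
    have hs : ∀ x, ∃ s : ℕ, (s : ℤ) = q z - q x := fun x => by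
      have := hz x
      exact ⟨(q z - q x).toNat, by omega⟩
    choose s hs using hs
    let E₀ : Finset α := Finset.univ.filter fun x => (2 * ((s x + 1) / 2) : ℕ) < p x + q z
    let E₁ : Finset α := Finset.univ.filter fun x => (2 * (s x / 2) + 1 : ℕ) < p x + q z
    have h₀ : E₀.card ≤ dFam r (k + 1) := by
      refine IsLeveled.card_le_dFam (lev := fun x => (s x + 1) / 2) (K := Finset.range (k + 1))
        ⟨fun x hx => ?_, fun x hx y hy hxy hne heq => ?_⟩ (by simp)
      · have h1 := (Finset.mem_filter.1 hx).2
        have := hall z x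
        simp only [Finset.mem_range]
        omega
      · have h1 := (Finset.mem_filter.1 hy).2
        have h2 := hlt x y hxy hne
        have h3 := hs x
        replace heq : (s x + 1) / 2 = (s y + 1) / 2 := heq
        omega
    have h₁ : E₁.card ≤ dFam r k := by
      refine IsLeveled.card_le_dFam (lev := fun x => s x / 2) (K := Finset.range k)
        ⟨fun x hx => ?_, fun x hx y hy hxy hne heq => ?_⟩ (by simp)
      · have h1 := (Finset.mem_filter.1 hx).2
        have := hall z x
        simp only [Finset.mem_range]
        omega
      · have h1 := (Finset.mem_filter.1 hy).2
        have h2 := hlt x y hxy hne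
        have h3 := hs x
        replace heq : s x / 2 = s y / 2 := heq
        omega
    have hsum : ∑ x, (p x + q x) ≤ ((E₁.card + E₀.card : ℕ) : ℤ) := by
      rw [Finset.card_filter, Finset.card_filter, ← Finset.sum_add_distrib, Nat.cast_sum]
      refine Finset.sum_le_sum fun x _ => ?_
      have h1 := hself x
      have h2 := hs x
      split_ifs <;> push_cast <;> omega
    refine hsum.trans ?_
    exact_mod_cast add_le_add h₁ h₀

/-- The Greene–Kleitman theorem: some chain partition is both `k`- and `(k + 1)`-saturated. -/
theorem exists_saturated (hr : IsPartialOrder α r) (hk : 0 < k) :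
    ∃ f : α → α, IsChainPartition r f ∧ knorm f k = dFam r k ∧
      knorm f (k + 1) = dFam r (k + 1) := by
  classical
  let _ : PartialOrder α :=
    { le := r
      le_refl := refl_of r
      le_trans := fun _ _ _ => trans_of r
      le_antisymm := fun _ _ => antisymm_of r }
  obtain ⟨σ, p, q, hpq, heq⟩ := exists_assignment_dual
    (fun x y : α => if x < y then (0 : ℤ) else if x = y then 2 else 2 * k + 1)
  obtain ⟨f, hend, hcomp, hfix⟩ := exists_ascent_partition σ
  have hf : IsChainPartition r f := fun i u hu v hv _ => hcomp u v (hu.trans hv.symm)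
  have hdual : ∑ x, (p x + q x) ≤ dFam r k + dFam r (k + 1) := by
    refine sum_potential_le p q (fun x y hxy hne => ?_) (fun x => ?_) (fun x y => ?_)
    · have hlt : x < y := lt_of_le_of_ne hxy hne
      simpa [hlt] using hpq x y
    · simpa using hpq x x
    · refine (hpq x y).trans ?_
      split_ifs <;> omega
  have hprimal : ((knorm f k + knorm f (k + 1) : ℕ) : ℤ) ≤ ∑ x, (p x + q x) := by
    have hperm : ∑ x, (p x + q x) = ∑ x, (p (σ x) + q x) := by
      rw [Finset.sum_add_distrib, Finset.sum_add_distrib, Equiv.sum_comp σ p]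
    rw [hperm, Finset.sum_congr rfl fun x _ => heq x, knorm_eq_sum, knorm_eq_sum,
      ← Finset.sum_add_distrib, Nat.cast_sum]
    refine Finset.sum_le_sum fun t _ => ?_
    split_ifs with h1 h2
    · have : Finset.univ.filter (fun v => f v = t) = ∅ := by
        refine Finset.filter_eq_empty_iff.2 fun v _ hv => ?_
        exact hend v (hv ▸ h1)
      simp [this]
    · have : (Finset.univ.filter (fun v => f v = t)).card ≤ 1 :=
        Finset.card_le_one.2 fun u hu v hv =>
          (hfix t h2.symm u (Finset.mem_filter.1 hu).2).trans
            (hfix t h2.symm v (Finset.mem_filter.1 hv).2).symm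
      omega
    · omega
  have h1 := dFam_le_knorm hf k
  have h2 := dFam_le_knorm hf (k + 1)
  have h3 : knorm f k + knorm f (k + 1) ≤ dFam r k + dFam r (k + 1) := by
    exact_mod_cast hprimal.trans hdual
  exact ⟨f, hf, by omega, by omega⟩

theorem knorm_concave (f : α → α) (k : ℕ) :
    knorm f k + knorm f (k + 2) ≤ 2 * knorm f (k + 1) := by
  unfold knorm
  rw [Finset.mul_sum, ← Finset.sum_add_distrib]
  exact Finset.sum_le_sum fun i _ => by omega

/-- In a polyunsaturated poset the differences of `dFam` strictly decrease in the middle range. -/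
theorem PolyunsatPO.lt_of_dFam_eq (hr : IsPartialOrder α r) (hP : PolyunsatPO r) {x y : ℕ}
    (hk : 0 < k) (hkc : k + 2 < heightPO r) (hx : dFam r (k + 1) = dFam r k + x)
    (hy : dFam r (k + 2) = dFam r (k + 1) + y) : y < x := by
  by_contra! hxy
  obtain ⟨f, hf, h1, h2⟩ := exists_saturated hr (Nat.succ_pos k)
  replace h1 : knorm f (k + 1) = dFam r (k + 1) := h1
  replace h2 : knorm f (k + 2) = dFam r (k + 2) := h2
  have h3 := knorm_concave f k
  have h4 := dFam_le_knorm hf k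
  exact hP k (k + 2) hk (by omega) (by omega) hkc (Or.inl le_rfl) ⟨f, hf, by omega, h2⟩

end GreeneKleitman

section Comb

/-- The number of comb cells in the row that contributes to `b k`. -/
def combWidth (c k : ℕ) : ℕ := max 1 (min (c - k) (c - 2))

/-- The columns occupied in row `r`: those of the comb, then those of the additional chains. -/
def rowCols (c : ℕ) (b : ℕ → ℕ) (r : ℕ) : Finset ℕ :=
  Finset.range (combWidth c (c - r)) ∪ Finset.Ico c (c + (b (c - r) - combWidth c (c - r)))

/-- The elements `(r, p)` of the comb poset: column `0` is the spine, column `p` with `1 ≤ p < c`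
consists of a minimal element in row `p + 1` and a tooth above it, and columns `p ≥ c` are
isolated chains. -/
def combCells (c : ℕ) (b : ℕ → ℕ) : Finset (ℕ × ℕ) :=
  (Finset.range c).biUnion fun r => (rowCols c b r).image (Prod.mk r)

/-- The first linear order defining the comb poset. -/
def combKey (u : ℕ × ℕ) : ℤ ×ₗ ℤ ×ₗ ℤ :=
  if u.2 = 0 then toLex ((u.1 : ℤ), toLex (2, 0))
  else if u.1 = u.2 + 1 then toLex ((u.2 : ℤ) + 1, toLex (1, 0))
  else toLex ((u.2 : ℤ) + 1, toLex (0, (u.1 : ℤ)))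

/-- The second linear order defining the comb poset. -/
def combKey' (c : ℕ) (u : ℕ × ℕ) : ℤ ×ₗ ℤ ×ₗ ℤ :=
  if c ≤ u.2 then toLex (0, toLex (-(u.2 : ℤ), (u.1 : ℤ)))
  else if u.2 = 0 then toLex (2, toLex ((u.1 : ℤ), 0))
  else if u.1 = u.2 + 1 then toLex (1, toLex (-(u.2 : ℤ), 0))
  else toLex (3, toLex (-(u.2 : ℤ), (u.1 : ℤ)))

theorem combKey_injective : Function.Injective combKey := by
  rintro ⟨r, p⟩ ⟨r', p'⟩ h
  simp only [combKey] at h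
  split_ifs at h <;> simp only [EmbeddingLike.apply_eq_iff_eq, Prod.mk.injEq] at h ⊢ <;> omega

theorem combKey'_injective (c : ℕ) : Function.Injective (combKey' c) := by
  rintro ⟨r, p⟩ ⟨r', p'⟩ h
  simp only [combKey'] at h
  split_ifs at h <;> simp only [EmbeddingLike.apply_eq_iff_eq, Prod.mk.injEq] at h ⊢ <;> omega

variable {c : ℕ} {b : ℕ → ℕ} {α : Type*} (e : α ≃ combCells c b)

def combRow (u : α) : ℕ := (e u).1.1

def combCol (u : α) : ℕ := (e u).1.2

/-- The order of the comb poset. -/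
def combRel (u v : α) : Prop :=
  combKey (e u).1 ≤ combKey (e v).1 ∧ combKey' c (e u).1 ≤ combKey' c (e v).1

theorem isLinearOrder_of_injective {β γ : Type*} [LinearOrder γ] {f : β → γ}
    (hf : Function.Injective f) : IsLinearOrder β (fun u v => f u ≤ f v) :=
  let _ := LinearOrder.lift' f hf
  (inferInstance : IsLinearOrder β (· ≤ ·))

theorem combRel_dimLE2 : DimLE2 (combRel e) :=
  ⟨fun u v => combKey (e u).1 ≤ combKey (e v).1,
    fun u v => combKey' c (e u).1 ≤ combKey' c (e v).1,
    isLinearOrder_of_injective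
      (combKey_injective.comp (Subtype.val_injective.comp e.injective)),
    isLinearOrder_of_injective
      ((combKey'_injective c).comp (Subtype.val_injective.comp e.injective)),
    fun _ _ h => h.1, fun _ _ h => h.2, fun _ _ => Iff.rfl⟩

theorem combRel_isPartialOrder : IsPartialOrder α (combRel e) where
  refl _ := ⟨le_rfl, le_rfl⟩
  trans _ _ _ h h' := ⟨h.1.trans h'.1, h.2.trans h'.2⟩
  antisymm _ _ h h' :=
    e.injective (Subtype.val_injective (combKey_injective (le_antisymm h.1 h'.1)))

theorem mem_combCells {r p : ℕ} : (r, p) ∈ combCells c b ↔ r < c ∧ p ∈ rowCols c b r := by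
  simp only [combCells, Finset.mem_biUnion, Finset.mem_range, Finset.mem_image, Prod.mk.injEq]
  constructor
  · rintro ⟨_, hr, _, hp, rfl, rfl⟩
    exact ⟨hr, hp⟩
  · rintro ⟨hr, hp⟩
    exact ⟨r, hr, p, hp, rfl, rfl⟩

theorem comb_mem (u : α) : combRow e u < c ∧ combCol e u ∈ rowCols c b (combRow e u) :=
  mem_combCells.1 (e u).2

theorem comb_valid (u : α) : combRow e u < c ∧ (combCol e u = 0 ∨
    (1 ≤ combCol e u ∧ combCol e u < combRow e u ∧ combCol e u + 2 < c) ∨ c ≤ combCol e u) := by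
  have h := comb_mem e u
  simp only [rowCols, combWidth, Finset.mem_union, Finset.mem_range, Finset.mem_Ico] at h
  omega

theorem comb_ext {u v : α} (h : combRow e u = combRow e v) (h' : combCol e u = combCol e v) :
    u = v :=
  e.injective (Subtype.val_injective (Prod.ext h h'))

theorem exists_cell_of_mem {r p : ℕ} (hr : r < c) (hp : p ∈ rowCols c b r) :
    ∃ u, combRow e u = r ∧ combCol e u = p :=
  ⟨e.symm ⟨(r, p), mem_combCells.2 ⟨hr, hp⟩⟩, by simp [combRow], by simp [combCol]⟩

theorem exists_cell {r p : ℕ} (hr : r < c) (hp : p = 0 ∨ (p < r ∧ p + 2 < c)) :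
    ∃ u, combRow e u = r ∧ combCol e u = p := by
  refine exists_cell_of_mem e hr ?_
  simp only [rowCols, combWidth, Finset.mem_union, Finset.mem_range, Finset.mem_Ico]
  omega

theorem exists_cell_above
    (hb : ∀ k, 1 ≤ k → k < c → b (k + 1) - combWidth c (k + 1) ≤ b k - combWidth c k)
    (u : α) (hu : c ≤ combCol e u) {r : ℕ} (hur : combRow e u ≤ r) (hr : r < c) :
    ∃ v, combRow e v = r ∧ combCol e v = combCol e u := by
  induction r, hur using Nat.le_induction with
  | base => exact ⟨u, rfl, rfl⟩
  | succ r _ ih =>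
    obtain ⟨v, hv, hvu⟩ := ih (by omega)
    refine exists_cell_of_mem e hr ?_
    have h := (comb_mem e v).2
    have h1 := hb (c - (r + 1)) (by omega) (by omega)
    rw [show c - (r + 1) + 1 = c - r by omega] at h1
    rw [hv, hvu] at h
    simp only [rowCols, Finset.mem_union, Finset.mem_range, Finset.mem_Ico] at h ⊢
    rcases h with h | h
    · unfold combWidth at h; omega
    · omega

theorem combRel_iff (u v : α) : combRel e u v ↔
    (combCol e u = combCol e v ∧ combRow e u ≤ combRow e v ∧
      (combCol e u = 0 ∨ c ≤ combCol e u ∨ combRow e u = combRow e v ∨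
        combCol e u + 1 < combRow e u)) ∨
    (combCol e u = 0 ∧ 1 ≤ combCol e v ∧ combCol e v < c ∧
      combCol e v + 1 < combRow e v ∧ combRow e u < combCol e v + 1) ∨
    (1 ≤ combCol e u ∧ combCol e u < c ∧ combRow e u = combCol e u + 1 ∧
      combCol e v = 0 ∧ combRow e u ≤ combRow e v) ∨
    (1 ≤ combCol e u ∧ combCol e u < c ∧ combRow e u = combCol e u + 1 ∧
      1 ≤ combCol e v ∧ combCol e v < c ∧ combCol e v + 1 < combRow e v ∧
      combCol e u < combCol e v) := by
  have hu := comb_valid e u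
  have hv := comb_valid e v
  unfold combRel combKey combKey'
  simp only [show (e u).1.1 = combRow e u from rfl, show (e u).1.2 = combCol e u from rfl,
    show (e v).1.1 = combRow e v from rfl, show (e v).1.2 = combCol e v from rfl]
  generalize combRow e u = r at *
  generalize combCol e u = p at *
  generalize combRow e v = r' at *
  generalize combCol e v = p' at *
  split_ifs <;> simp only [Prod.Lex.toLex_le_toLex, true_and] <;> omega

section Leveled

variable [Fintype α]

/-- The elements in the top `k` rows. -/
def topRows (k : ℕ) : Finset α := Finset.univ.filter fun u => c - k ≤ combRow e u

/-- The top `k` rows with the spine shifted down by one row and then avoiding row `m`. -/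
def combFam (k m : ℕ) : Finset α := Finset.univ.filter fun u =>
  (combCol e u = 0 ∧ c - k - 1 ≤ combRow e u ∧ combRow e u ≠ m) ∨
    (combCol e u ≠ 0 ∧ c - k ≤ combRow e u)

/-- The levels witnessing that `combFam e k m` is a `k`-family. -/
def combLev (k m : ℕ) (u : α) : ℕ :=
  if combCol e u = 0 then (if combRow e u < m then combRow e u + 1 else combRow e u)
  else if combRow e u = combCol e u + 1 then c - k else combRow e u

theorem mem_combFam {k m : ℕ} {u : α} : u ∈ combFam e k m ↔
    (combCol e u = 0 ∧ c - k - 1 ≤ combRow e u ∧ combRow e u ≠ m) ∨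
      (combCol e u ≠ 0 ∧ c - k ≤ combRow e u) := by
  simp [combFam]

theorem isLeveled_combFam {k m : ℕ} (hkc : k < c) (hm : c - k ≤ m) (hmc : m < c) :
    IsLeveled (combRel e) (combFam e k m) (combLev e k m) (Finset.Ico (c - k) c) := by
  refine ⟨fun u hu => ?_, fun u hu v hv huv hne => ?_⟩
  · rw [mem_combFam] at hu
    have := comb_valid e u
    unfold combLev
    rw [Finset.mem_Ico]
    split_ifs <;> omega
  · rw [mem_combFam] at hu hv
    rw [combRel_iff] at huv
    have h1 := comb_valid e u
    have h2 := comb_valid e v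
    have h3 : ¬ (combRow e u = combRow e v ∧ combCol e u = combCol e v) :=
      fun h => hne (comb_ext e h.1 h.2)
    unfold combLev
    split_ifs <;> omega

theorem isLeveled_univ : IsLeveled (combRel e) Finset.univ
    (fun u => if combCol e u = 0 then combRow e u
      else if combRow e u = combCol e u + 1 then 0 else combRow e u) (Finset.range c) := by
  refine ⟨fun u _ => ?_, fun u _ v _ huv hne => ?_⟩
  · have := comb_valid e u
    rw [Finset.mem_range]
    dsimp only
    split_ifs <;> omega
  · rw [combRel_iff] at huv
    have h1 := comb_valid e u
    have h2 := comb_valid e v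
    have h3 : ¬ (combRow e u = combRow e v ∧ combCol e u = combCol e v) :=
      fun h => hne (comb_ext e h.1 h.2)
    dsimp only
    split_ifs <;> omega

theorem card_combFam {k m : ℕ} (hkc : k < c) (hm : c - k ≤ m) (hmc : m < c) :
    (combFam e k m).card = (topRows e k).card := by
  classical
  obtain ⟨x, hx, hx'⟩ := exists_cell e (r := c - k - 1) (p := 0) (by omega) (Or.inl rfl)
  obtain ⟨y, hy, hy'⟩ := exists_cell e (r := m) (p := 0) hmc (Or.inl rfl)
  have hyt : y ∈ topRows e k := by
    simp only [topRows, hy, Finset.mem_filter, Finset.mem_univ, true_and]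
    exact hm
  have h : combFam e k m = insert x ((topRows e k).erase y) := by
    ext u
    have hux : u = x ↔ combRow e u = c - k - 1 ∧ combCol e u = 0 :=
      ⟨fun h => h ▸ ⟨hx, hx'⟩, fun h => comb_ext e (h.1.trans hx.symm) (h.2.trans hx'.symm)⟩
    have huy : u = y ↔ combRow e u = m ∧ combCol e u = 0 :=
      ⟨fun h => h ▸ ⟨hy, hy'⟩, fun h => comb_ext e (h.1.trans hy.symm) (h.2.trans hy'.symm)⟩
    simp only [mem_combFam, Finset.mem_insert, Finset.mem_erase, topRows, Finset.mem_filter,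
      Finset.mem_univ, true_and, ne_eq, hux, huy]
    omega
  rw [h, Finset.card_insert_of_notMem, Finset.card_erase_of_mem hyt]
  · have := Finset.card_pos.2 ⟨y, hyt⟩
    omega
  · simp [topRows, hx]
    omega

theorem card_topRows_succ (hb : ∀ k, 1 ≤ k → k ≤ c → combWidth c k ≤ b k) {k : ℕ} (hkc : k < c) :
    (topRows e (k + 1)).card = (topRows e k).card + b (k + 1) := by
  classical
  have hrow : (Finset.univ.filter fun u => combRow e u = c - (k + 1)).card = b (k + 1) := by
    have h1 : (Finset.univ.filter fun u => combRow e u = c - (k + 1)).image (combCol e) =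
        rowCols c b (c - (k + 1)) := by
      ext p
      simp only [Finset.mem_image, Finset.mem_filter, Finset.mem_univ, true_and]
      constructor
      · rintro ⟨u, hu, rfl⟩
        exact hu ▸ (comb_mem e u).2
      · exact fun hp => exists_cell_of_mem e (by omega) hp
    rw [← Finset.card_image_of_injOn (f := combCol e), h1, rowCols, Finset.card_union_of_disjoint,
      Finset.card_range, Nat.card_Ico, show c - (c - (k + 1)) = k + 1 by omega]
    · have := hb (k + 1) (by omega) (by omega)
      omega
    · refine Finset.disjoint_left.2 fun p hp hp' => ?_
      simp only [combWidth, Finset.mem_range, Finset.mem_Ico] at hp hp'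
      omega
    · intro u hu v hv huv
      simp only [Finset.coe_filter, Finset.mem_univ, true_and, Set.mem_ofPred_eq] at hu hv
      exact comb_ext e (hu.trans hv.symm) huv
  rw [← hrow, ← Finset.card_union_of_disjoint]
  · congr 1
    ext u
    simp only [topRows, Finset.mem_union, Finset.mem_filter, Finset.mem_univ, true_and]
    omega
  · refine Finset.disjoint_left.2 fun u hu hu' => ?_
    simp only [topRows, Finset.mem_filter, Finset.mem_univ, true_and] at hu hu'
    omega

/-- The partition of the comb poset into chains which shows that `combFam` is optimal. -/
def combChain (k : ℕ) (u : α) : ℕ × ℕ :=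
  if c ≤ combCol e u then (0, combCol e u)
  else if combCol e u = 0 then (1, min (max (combRow e u + 1) 2) (combWidth c k + 1))
  else if combCol e u + 1 ≤ combWidth c k then
    (1, if combRow e u = combCol e u + 1 then combCol e u + 2 else combCol e u + 1)
  else (combRow e u + 2, combCol e u)

omit [Fintype α] in
theorem combChain_comparable {k : ℕ} {u v : α}
    (h : combChain e k u = combChain e k v) : combRel e u v ∨ combRel e v u := by
  rw [combRel_iff, combRel_iff]
  have h1 := comb_valid e u
  have h2 := comb_valid e v
  have hJ : 1 ≤ combWidth c k := by unfold combWidth; omega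
  unfold combChain at h
  generalize combWidth c k = J at *
  generalize combRow e u = r at *
  generalize combCol e u = p at *
  generalize combRow e v = r' at *
  generalize combCol e v = p' at *
  rcases le_total r r' with hr | hr <;> rcases le_total p p' with hp | hp <;>
    split_ifs at h <;> simp only [Prod.mk.injEq, true_and] at h <;>
    first
    | exact absurd h (by omega)
    | exact Or.inl (Or.inl (by omega))
    | exact Or.inr (Or.inl (by omega))
    | exact Or.inl (Or.inr (Or.inl (by omega)))
    | exact Or.inr (Or.inr (Or.inl (by omega)))
    | exact Or.inl (Or.inr (Or.inr (Or.inl (by omega))))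
    | exact Or.inr (Or.inr (Or.inr (Or.inl (by omega))))
    | exact Or.inl (Or.inr (Or.inr (Or.inr (by omega))))
    | exact Or.inr (Or.inr (Or.inr (Or.inr (by omega))))

theorem combChain_slack
    (hb : ∀ k, 1 ≤ k → k < c → b (k + 1) - combWidth c (k + 1) ≤ b k - combWidth c k)
    {k : ℕ} (hk : 0 < k) (hkc : k < c) (u : α) (hu : u ∉ combFam e k (c - 1)) (l : ℕ)
    (hl : l ∈ Finset.Ico (c - k) c) :
    ∃ v ∈ combFam e k (c - 1), combChain e k v = combChain e k u ∧ combLev e k (c - 1) v = l := by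
  rw [Finset.mem_Ico] at hl
  rw [mem_combFam] at hu
  have hvu := comb_valid e u
  simp only [mem_combFam]
  by_cases hext : c ≤ combCol e u
  · obtain ⟨v, hv, hv'⟩ := exists_cell_above e hb u hext (r := l) (by omega) hl.2
    refine ⟨v, by omega, ?_, ?_⟩
    · simp [combChain, hv', hext]
    · unfold combLev; split_ifs <;> omega
  obtain ⟨q, hq, hq2, hqJ⟩ : ∃ q, combChain e k u = (1, q) ∧ 2 ≤ q ∧ q ≤ combWidth c k + 1 := by
    unfold combChain combWidth
    rw [if_neg hext]
    split_ifs
    · exact ⟨_, rfl, by omega, by omega⟩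
    · exact ⟨_, rfl, by omega, by omega⟩
    · exact ⟨_, rfl, by omega, by omega⟩
    · omega
  rw [hq]
  by_cases h1 : q < l ∧ q ≤ combWidth c k
  · obtain ⟨v, hv, hv'⟩ := exists_cell e (r := l) (p := q - 1) (by omega)
      (by unfold combWidth at h1; omega)
    refine ⟨v, by omega, ?_, ?_⟩
    · unfold combWidth at h1
      unfold combChain combWidth
      split_ifs <;> simp only [Prod.mk.injEq, true_and] <;> omega
    · unfold combLev; split_ifs <;> omega
  by_cases h2 : l = combWidth c k ∧ q = combWidth c k + 1 ∧ 2 ≤ combWidth c k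
  · obtain ⟨v, hv, hv'⟩ := exists_cell e (r := l) (p := l - 1) (by omega)
      (by unfold combWidth at h2; omega)
    refine ⟨v, by omega, ?_, ?_⟩
    · unfold combWidth at h2
      unfold combChain combWidth
      split_ifs <;> simp only [Prod.mk.injEq, true_and] <;> omega
    · unfold combWidth at h2
      unfold combLev; split_ifs <;> omega
  · unfold combWidth at h1 h2 hqJ
    obtain ⟨v, hv, hv'⟩ := exists_cell e (r := l - 1) (p := 0) (by omega) (Or.inl rfl)
    refine ⟨v, by omega, ?_, ?_⟩
    · unfold combChain combWidth
      split_ifs <;> simp only [Prod.mk.injEq, true_and] <;> omega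
    · unfold combLev; split_ifs <;> omega

theorem dFam_combRel
    (hb : ∀ k, 1 ≤ k → k < c → b (k + 1) - combWidth c (k + 1) ≤ b k - combWidth c k)
    {k : ℕ} (hkc : k ≤ c) : dFam (combRel e) k = (topRows e k).card := by
  rcases Nat.eq_zero_or_pos k with rfl | hk
  · obtain ⟨A, -, hA⟩ := exists_ncard_eq_dFam (combRel e) 0
    rw [← hA]
    symm
    simp only [Set.iUnion_of_empty, Set.ncard_empty, Finset.card_eq_zero, topRows,
      Finset.filter_eq_empty_iff]
    intro u _
    have := comb_valid e u
    omega
  rcases hkc.eq_or_lt with rfl | hkc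
  · have h : topRows e k = Finset.univ := by ext; simp [topRows]
    rw [h]
    refine le_antisymm ?_ ((isLeveled_univ e).card_le_dFam (by simp))
    obtain ⟨T, hT, -⟩ := exists_kFamily (combRel e) k
    exact hT ▸ Finset.card_le_card (Finset.subset_univ T)
  · rw [← card_combFam e (m := c - 1) hkc (by omega) (by omega)]
    refine le_antisymm ?_ ((isLeveled_combFam e hkc (by omega) (by omega)).card_le_dFam ?_)
    · refine dFam_le_of_slack (combChain e k) (fun u v => combChain_comparable e) _
        (combLev e k (c - 1)) (Finset.Ico (c - k) c) ?_ (combChain_slack e hb hk hkc)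
      rw [Nat.card_Ico]; omega
    · rw [Nat.card_Ico]; omega

theorem heightPO_combRel : heightPO (combRel e) = c := by
  classical
  refine heightPO_eq (isLeveled_univ e) (C := Finset.univ.filter fun u => combCol e u = 0) ?_ ?_
  · intro u hu v hv _
    simp only [Finset.coe_filter, Finset.mem_univ, true_and, Set.mem_ofPred_eq] at hu hv
    rcases le_total (combRow e u) (combRow e v) with h | h
    · exact Or.inl ((combRel_iff e u v).2 (Or.inl ⟨hu.trans hv.symm, h, Or.inl hu⟩))
    · exact Or.inr ((combRel_iff e v u).2 (Or.inl ⟨hv.trans hu.symm, h, Or.inl hv⟩))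
  · rw [← Finset.card_image_of_injOn (f := combRow e)]
    · refine Eq.trans (congrArg Finset.card ?_) (Finset.card_range c)
      ext r
      simp only [Finset.mem_image, Finset.mem_filter, Finset.mem_univ, true_and, Finset.mem_range]
      constructor
      · rintro ⟨u, -, rfl⟩
        exact (comb_valid e u).1
      · intro hr
        obtain ⟨u, hu, hu'⟩ := exists_cell e (p := 0) hr (Or.inl rfl)
        exact ⟨u, hu', hu⟩
    · intro u hu v hv huv
      simp only [Finset.coe_filter, Finset.mem_univ, true_and, Set.mem_ofPred_eq] at hu hv
      exact comb_ext e huv (hu.trans hv.symm)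

theorem combRel_not_saturated
    (hb : ∀ k, 1 ≤ k → k < c → b (k + 1) - combWidth c (k + 1) ≤ b k - combWidth c k)
    {k l : ℕ} (hk : 0 < k) (hkl : k + 2 ≤ l) (hlc : l < c) {f : α → α}
    (hf : IsChainPartition (combRel e) f) (hfk : knorm f k = dFam (combRel e) k)
    (hfl : knorm f l = dFam (combRel e) l) : False := by
  rw [dFam_combRel e hb (by omega)] at hfk hfl
  rw [← card_combFam e (m := c - 1) (by omega) (by omega) (by omega)] at hfk
  rw [← card_combFam e (m := c - k - 1) (by omega) (by omega) (by omega)] at hfl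
  obtain ⟨x, hx, hx'⟩ := exists_cell e (r := c - k - 1) (p := 0) (by omega) (Or.inl rfl)
  obtain ⟨y, hy, hy'⟩ := exists_cell e (r := c - k - 1) (p := c - k - 2) (by omega) (by omega)
  obtain ⟨v, hv, hvy, hvl⟩ := slack_of_saturated hf
    (isLeveled_combFam e (k := k) (m := c - 1) (by omega) (by omega) (by omega))
    (by rw [Nat.card_Ico]; omega) hfk.le (u := y) (by rw [mem_combFam]; omega) (l := c - k)
    (by rw [Finset.mem_Ico]; omega)
  obtain ⟨w, hw, hwx, hwl⟩ := slack_of_saturated hf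
    (isLeveled_combFam e (k := l) (m := c - k - 1) (by omega) (by omega) (by omega))
    (by rw [Nat.card_Ico]; omega) hfl.le (u := x) (by rw [mem_combFam]; omega) (l := c - k - 1)
    (by rw [Finset.mem_Ico]; omega)
  rw [mem_combFam] at hv hw
  have hv1 := comb_valid e v
  have hw1 := comb_valid e w
  have hvne : v ≠ y := by rintro rfl; omega
  have hvx : v = x := by
    have := hf.comparable hvy hvne
    rw [combRel_iff, combRel_iff] at this
    unfold combLev at hvl
    refine comb_ext e ?_ ?_ <;> split_ifs at hvl <;> omega
  have hwne : w ≠ x := by rintro rfl; omega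
  have hw2 : combRow e w = c - k - 2 ∧ combCol e w = 0 := by
    have := hf.comparable hwx hwne
    rw [combRel_iff, combRel_iff] at this
    unfold combLev at hwl
    split_ifs at hwl <;> omega
  subst hvx
  have hwy : w ≠ y := by rintro rfl; omega
  have := hf.comparable (hwx.trans hvy) hwy
  rw [combRel_iff, combRel_iff] at this
  omega

theorem combRel_polyunsat
    (hb : ∀ k, 1 ≤ k → k < c → b (k + 1) - combWidth c (k + 1) ≤ b k - combWidth c k) :
    PolyunsatPO (combRel e) := by
  rintro k l hk hl hkc hlc hkl ⟨f, hf, hfk, hfl⟩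
  rw [heightPO_combRel] at hkc hlc
  rcases hkl with h | h
  · exact combRel_not_saturated e hb hk h hlc hf hfk hfl
  · exact combRel_not_saturated e hb hl h hkc hf hfl hfk

end Leveled

end Comb

theorem combWidth_le {c : ℕ} {b : ℕ → ℕ} (hpos : ∀ k, 1 ≤ k → k ≤ c → 0 < b k)
    (hmono : ∀ k l, 1 ≤ k → k ≤ l → l ≤ c → b l ≤ b k)
    (hb : ∀ k, 2 ≤ k → k + 2 ≤ c → b (k + 1) < b k) {k : ℕ} (hk : 1 ≤ k) (hkc : k ≤ c) :
    combWidth c k ≤ b k := by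
  induction hkc using Nat.decreasingInduction with
  | self => have := hpos c hk le_rfl; unfold combWidth; omega
  | of_succ k hkc ih =>
    have h1 := ih (by omega)
    have h2 := hmono k (k + 1) hk (by omega) hkc
    unfold combWidth at h1 ⊢
    by_cases h : 2 ≤ k ∧ k + 2 ≤ c
    · have := hb k h.1 h.2
      omega
    · omega

theorem exists_polyunsat {c : ℕ} {b : ℕ → ℕ} (hpos : ∀ k, 1 ≤ k → k ≤ c → 0 < b k)
    (hmono : ∀ k l, 1 ≤ k → k ≤ l → l ≤ c → b l ≤ b k)
    (hb : ∀ k, 2 ≤ k → k + 2 ≤ c → b (k + 1) < b k) :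
    ∃ (m : ℕ) (r : Fin m → Fin m → Prop),
      IsPartialOrder (Fin m) r ∧ heightPO r = c ∧ PolyunsatPO r ∧
      (∀ k, 1 ≤ k → k ≤ c → dFam r k = dFam r (k - 1) + b k) ∧ DimLE2 r := by
  have hdiff : ∀ k, 1 ≤ k → k < c → b (k + 1) - combWidth c (k + 1) ≤ b k - combWidth c k := by
    intro k hk hkc
    have h1 := hmono k (k + 1) hk (by omega) hkc
    unfold combWidth
    by_cases h : 2 ≤ k ∧ k + 2 ≤ c
    · have := hb k h.1 h.2
      omega
    · omega
  let e : Fin (combCells c b).card ≃ combCells c b := (combCells c b).equivFin.symm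
  refine ⟨_, combRel e, combRel_isPartialOrder e, heightPO_combRel e, combRel_polyunsat e hdiff,
    fun k hk hkc => ?_, combRel_dimLE2 e⟩
  obtain ⟨k, rfl⟩ := Nat.exists_eq_succ_of_ne_zero (by omega : k ≠ 0)
  rw [Nat.succ_sub_one, dFam_combRel e hdiff hkc, dFam_combRel e hdiff (by omega)]
  exact card_topRows_succ e (fun _ => combWidth_le hpos hmono hb) hkc

/-- For a positive integer `c` and a nonincreasing sequence `b 1 ≥ … ≥ b c` of positive
integers: there exists a polyunsaturated poset `P` of height `c` with `Δd_k(P) = b k` for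
`k = 1, …, c` if and only if `b 2 > b 3 > … > b (c-1)`; moreover, in that case `P` may be
required to have order dimension at most 2. -/
theorem statement11 (c : ℕ) (hc : 0 < c) (b : ℕ → ℕ)
    (hpos : ∀ k, 1 ≤ k → k ≤ c → 0 < b k)
    (hmono : ∀ k l, 1 ≤ k → k ≤ l → l ≤ c → b l ≤ b k) :
    ((∃ (m : ℕ) (r : Fin m → Fin m → Prop),
        IsPartialOrder (Fin m) r ∧ heightPO r = c ∧ PolyunsatPO r ∧
        (∀ k, 1 ≤ k → k ≤ c → dFam r k = dFam r (k - 1) + b k)) ↔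
      (∀ k, 2 ≤ k → k + 2 ≤ c → b (k + 1) < b k)) ∧
    ((∀ k, 2 ≤ k → k + 2 ≤ c → b (k + 1) < b k) →
      ∃ (m : ℕ) (r : Fin m → Fin m → Prop),
        IsPartialOrder (Fin m) r ∧ heightPO r = c ∧ PolyunsatPO r ∧
        (∀ k, 1 ≤ k → k ≤ c → dFam r k = dFam r (k - 1) + b k) ∧
        DimLE2 r) := by
  refine ⟨⟨?_, fun hb => ?_⟩, exists_polyunsat hpos hmono⟩
  · rintro ⟨m, r, hr, hh, hP, hd⟩ k hk hkc
    obtain ⟨j, rfl⟩ := Nat.exists_eq_add_of_le hk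
    have h1 := hd (2 + j) (by omega) (by omega)
    have h2 := hd (2 + j + 1) (by omega) (by omega)
    rw [show 2 + j - 1 = j + 1 by omega, show 2 + j = j + 2 by omega] at h1
    rw [show 2 + j + 1 - 1 = j + 2 by omega, show 2 + j + 1 = j + 3 by omega] at h2
    rw [show 2 + j + 1 = j + 3 by omega, show 2 + j = j + 2 by omega]
    exact hP.lt_of_dFam_eq hr (Nat.succ_pos j) (by omega) h1 h2
  · obtain ⟨m, r, h1, h2, h3, h4, -⟩ := exists_polyunsat hpos hmono hb
    exact ⟨m, r, h1, h2, h3, h4⟩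
end
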